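/- Let r : Fin n → ℕ be a family of independent random variables, each geometrically distributed with P(r(i) = k) = 1/2^{k+1}, and suppose n ≥ 2. For every index i, the expected number of indices j ≥ i such that r(j) > r(z) for all z with i ≤ z < j is at most (1/2)·lg n + 2. -/

import Mathlib

open scoped ENNReal

/-- A sum over `Fin n → ℕ` of a product of functions of the coordinates factors. -/
theorem tsum_pi_prod_eq_prod_tsum (n : ℕ) (g : Fin n → ℕ → ℝ≥0∞) :
    ∑' f : Fin n → ℕ, ∏ j, g j (f j) = ∏ j, ∑' x, g j x := by
  induction n with
  | zero => simp
  | succ n ih =>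
    rw [← (Fin.consEquiv fun _ : Fin (n + 1) => ℕ).tsum_eq, ENNReal.tsum_prod', Fin.prod_univ_succ,
      ← ih fun j => g j.succ, ← ENNReal.tsum_mul_right]
    refine tsum_congr fun x => ?_
    rw [← ENNReal.tsum_mul_left]
    refine tsum_congr fun f => ?_
    simp [Fin.prod_univ_succ, Fin.consEquiv]

theorem sum_range_half_pow_succ_add (k : ℕ) :
    ∑ x ∈ Finset.range k, (1 / 2 : ℝ≥0∞) ^ (x + 1) + (1 / 2) ^ k = 1 := by
  induction k with
  | zero => simp
  | succ k ih =>
    rw [Finset.sum_range_succ, add_assoc, pow_succ, ← mul_add, ENNReal.add_halves, mul_one, ih]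

theorem tsum_half_pow_succ : ∑' x : ℕ, (1 / 2 : ℝ≥0∞) ^ (x + 1) = 1 := by
  simpa [one_div, pow_succ, ENNReal.tsum_mul_right] using
    ENNReal.mul_inv_cancel (a := 2) (by simp) (by simp)

theorem tsum_half_pow_succ_of_lt (k : ℕ) :
    ∑' x : ℕ, (1 / 2 : ℝ≥0∞) ^ (x + 1) * (if x < k then 1 else 0) =
      ∑ x ∈ Finset.range k, (1 / 2 : ℝ≥0∞) ^ (x + 1) := by
  rw [tsum_eq_sum (s := Finset.range k) (by intro b hb; simp_all)]
  exact Finset.sum_congr rfl fun x hx => by simp [Finset.mem_range.mp hx]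

theorem sum_range_pow_mul_le_one {p q : ℝ≥0∞} (h : q + p = 1) (m : ℕ) :
    ∑ d ∈ Finset.range m, q ^ d * p ≤ 1 := by
  have key : ∑ d ∈ Finset.range m, q ^ d * p + q ^ m = 1 := by
    induction m with
    | zero => simp
    | succ m ih =>
      rw [Finset.sum_range_succ, add_assoc, pow_succ, ← mul_add, add_comm p q, h, mul_one, ih]
  exact key ▸ le_self_add

/-- The probability that `j` is a strict record of the sequence started at `i`, with value `k`. -/
theorem tsum_record_eq {n : ℕ} {i j : Fin n} (hij : i ≤ j) (k : ℕ) :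
    ∑' f : Fin n → ℕ, (∏ l, (1 / 2 : ℝ≥0∞) ^ (f l + 1)) *
        (if f j = k ∧ ∀ z, i ≤ z → z < j → f z < k then 1 else 0) =
      (1 / 2) ^ (k + 1) *
        (∑ x ∈ Finset.range k, (1 / 2 : ℝ≥0∞) ^ (x + 1)) ^ ((j : ℕ) - i) := by
  let g : Fin n → ℕ → ℝ≥0∞ := fun l x => (1 / 2 : ℝ≥0∞) ^ (x + 1) *
    (if (l = j → x = k) ∧ (i ≤ l → l < j → x < k) then 1 else 0)
  have hg (f : Fin n → ℕ) : (∏ l, (1 / 2 : ℝ≥0∞) ^ (f l + 1)) *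
      (if f j = k ∧ ∀ z, i ≤ z → z < j → f z < k then 1 else 0) = ∏ l, g l (f l) := by
    rw [Finset.prod_mul_distrib, Finset.prod_ite_zero, Finset.prod_const_one]
    congr 2
    simp [forall_and]
  have hgs (l : Fin n) : ∑' x, g l x = (if l = j then (1 / 2) ^ (k + 1) else 1) *
      (if l ∈ Finset.Ico i j then ∑ x ∈ Finset.range k, (1 / 2 : ℝ≥0∞) ^ (x + 1) else 1) := by
    rcases eq_or_ne l j with rfl | hl
    · simp only [g, lt_irrefl, mul_ite, mul_one, mul_zero]
      simp
    · by_cases h : i ≤ l ∧ l < j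
      · simp only [g, hl, h, Finset.mem_Ico, true_and, and_self, if_true, if_false, one_mul,
          forall_true_left, false_imp_iff]
        exact tsum_half_pow_succ_of_lt k
      · have h' (x : ℕ) : i ≤ l → l < j → x < k := fun h₁ h₂ => absurd ⟨h₁, h₂⟩ h
        simpa [g, hl, h, fun x => eq_true (h' x)] using tsum_half_pow_succ
  simp_rw [hg]
  rw [tsum_pi_prod_eq_prod_tsum, Finset.prod_congr rfl fun l _ => hgs l, Finset.prod_mul_distrib,
    Finset.prod_ite_eq' Finset.univ j, Finset.prod_ite_mem]
  simp

theorem sum_record_le {n : ℕ} (i : Fin n) (k : ℕ) :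
    ∑ j ∈ Finset.Ici i, (1 / 2 : ℝ≥0∞) ^ (k + 1) *
        (∑ x ∈ Finset.range k, (1 / 2 : ℝ≥0∞) ^ (x + 1)) ^ ((j : ℕ) - i) ≤
      1 / 2 * min 1 ((n : ℝ≥0∞) * (1 / 2) ^ k) := by
  set q := ∑ x ∈ Finset.range k, (1 / 2 : ℝ≥0∞) ^ (x + 1)
  have hq : q + (1 / 2) ^ k = 1 := sum_range_half_pow_succ_add k
  have hreindex : ∑ j ∈ Finset.Ici i, q ^ ((j : ℕ) - i) * (1 / 2) ^ k ≤
      ∑ d ∈ Finset.range n, q ^ d * (1 / 2) ^ k := by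
    rw [← Finset.sum_image (s := Finset.Ici i) (g := fun j : Fin n => (j : ℕ) - i)
      (f := fun d => q ^ d * (1 / 2 : ℝ≥0∞) ^ k)]
    · refine Finset.sum_le_sum_of_subset fun d hd => ?_
      obtain ⟨j, -, rfl⟩ := Finset.mem_image.mp hd
      exact Finset.mem_range.mpr (by omega)
    · intro a ha b hb hab
      simp only [Finset.coe_Ici, Set.mem_Ici, Fin.le_def] at ha hb hab
      omega
  calc _ = 1 / 2 * ∑ j ∈ Finset.Ici i, q ^ ((j : ℕ) - i) * (1 / 2) ^ k := by
        rw [Finset.mul_sum]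
        exact Finset.sum_congr rfl fun j _ => by ring
    _ ≤ _ := by
        refine mul_le_mul_right (hreindex.trans (le_min (sum_range_pow_mul_le_one hq n) ?_)) _
        calc _ ≤ ∑ d ∈ Finset.range n, (1 / 2 : ℝ≥0∞) ^ k :=
              Finset.sum_le_sum fun d _ =>
                mul_le_of_le_one_left' (pow_le_one' (hq ▸ le_self_add) d)
          _ = _ := by simp

theorem tsum_half_mul_min_le {n K : ℕ} (hK : n ≤ 2 ^ K) :
    ∑' k : ℕ, 1 / 2 * min 1 ((n : ℝ≥0∞) * (1 / 2) ^ k) ≤ K / 2 + 1 := by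
  rw [← Summable.sum_add_tsum_nat_add' (k := K) ENNReal.summable]
  gcongr
  · calc _ ≤ ∑ k ∈ Finset.range K, (1 / 2 : ℝ≥0∞) :=
          Finset.sum_le_sum fun k _ => mul_le_of_le_one_right' (min_le_left _ _)
      _ = _ := by simp [div_eq_mul_inv]
  · have hn : (n : ℝ≥0∞) * (1 / 2) ^ K ≤ 1 := by
      rw [one_div, ← ENNReal.inv_pow, ← div_eq_mul_inv]
      exact ENNReal.div_le_of_le_mul (by rw [one_mul]; exact_mod_cast hK)
    calc _ ≤ ∑' k : ℕ, (1 / 2 : ℝ≥0∞) ^ (k + 1) := by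
          refine ENNReal.tsum_le_tsum fun k => ?_
          calc _ ≤ 1 / 2 * ((n : ℝ≥0∞) * (1 / 2) ^ (k + K)) := by gcongr; exact min_le_right _ _
            _ = (1 / 2) ^ (k + 1) * (n * (1 / 2) ^ K) := by ring
            _ ≤ _ := mul_le_of_le_one_right' hn
      _ = 1 := tsum_half_pow_succ

theorem natCard_record_eq {n : ℕ} (i : Fin n) (f : Fin n → ℕ) :
    ((Nat.card {j : Fin n // i ≤ j ∧ ∀ z : Fin n, i ≤ z → z < j → f z < f j} : ℕ) : ℝ≥0∞) =
      ∑ j ∈ Finset.Ici i, ∑' k : ℕ,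
        if f j = k ∧ ∀ z, i ≤ z → z < j → f z < k then 1 else 0 := by
  have h (j : Fin n) :
      (∑' k : ℕ, if f j = k ∧ ∀ z, i ≤ z → z < j → f z < k then (1 : ℝ≥0∞) else 0) =
      if ∀ z, i ≤ z → z < j → f z < f j then 1 else 0 := by
    rw [tsum_eq_single (f j) fun k hk => by simp [hk.symm]]
    simp
  rw [Finset.sum_congr rfl fun j _ => h j, Finset.sum_boole, Nat.card_eq_fintype_card,
    Fintype.card_subtype]
  congr 2
  ext j
  simp

/-- **Expected number of high ancestors (plus the node itself).** Let `r : Fin n → ℕ`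
be independent geometric random variables with `P(r i = k) = 1/2^(k+1)` (modelled by
the product PMF `μ`), and `n ≥ 2`. For every index `i`, the expected number of indices
`j ≥ i` such that `r j > r z` for all `z` with `i ≤ z < j` is at most
`(1/2)·lg n + 2`. -/
theorem expected_high_ancestors (n : ℕ) (hn : 2 ≤ n)
    (μ : PMF (Fin n → ℕ))
    (hμ : ∀ f : Fin n → ℕ, μ f = ∏ j : Fin n, (1 / 2 : ℝ≥0∞) ^ (f j + 1))
    (i : Fin n) :
    ∑' f : Fin n → ℕ,
        μ f * ((Nat.card {j : Fin n // i ≤ j ∧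
            ∀ z : Fin n, i ≤ z → z < j → f z < f j} : ℕ) : ℝ≥0∞) ≤
      ENNReal.ofReal ((1 / 2) * Real.logb 2 n + 2) := by
  have hn1 : (1 : ℝ) ≤ n := by exact_mod_cast (by omega : 1 ≤ n)
  have hclog : (Nat.clog 2 n : ℝ) ≤ Real.logb 2 n + 1 := by
    rw [← Real.natCeil_logb_natCast]
    exact (Nat.ceil_lt_add_one (Real.logb_nonneg (by norm_num) hn1)).le
  calc _ = ∑' k : ℕ, ∑ j ∈ Finset.Ici i, ∑' f : Fin n → ℕ,
        (∏ l, (1 / 2 : ℝ≥0∞) ^ (f l + 1)) *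
          (if f j = k ∧ ∀ z, i ≤ z → z < j → f z < k then 1 else 0) := by
        simp_rw [natCard_record_eq, hμ, Finset.mul_sum, ← ENNReal.tsum_mul_left]
        rw [Summable.tsum_finsetSum fun _ _ => ENNReal.summable,
          Summable.tsum_finsetSum fun _ _ => ENNReal.summable]
        exact Finset.sum_congr rfl fun j _ => ENNReal.tsum_comm
    _ ≤ ∑' k : ℕ, 1 / 2 * min 1 ((n : ℝ≥0∞) * (1 / 2) ^ k) := by
        refine ENNReal.tsum_le_tsum fun k => ?_
        rw [Finset.sum_congr rfl fun j hj => tsum_record_eq (Finset.mem_Ici.mp hj) k]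
        exact sum_record_le i k
    _ ≤ (Nat.clog 2 n : ℝ≥0∞) / 2 + 1 := tsum_half_mul_min_le (Nat.le_pow_clog one_lt_two n)
    _ = ENNReal.ofReal ((Nat.clog 2 n : ℝ) / 2 + 1) := by
        rw [ENNReal.ofReal_add (by positivity) zero_le_one, ENNReal.ofReal_div_of_pos two_pos]
        simp
    _ ≤ _ := ENNReal.ofReal_le_ofReal (by linarith)
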